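/- arXiv:2508.13418 — 2 statements merged into one kernel-verified Lean document; each statement's English description precedes it below -/
import Mathlib

section
/- Let T ∈ ℕ, let A_1, …, A_T be real m×n matrices and let M be a real n×n matrix. Then ‖∑_{t=1}^T A_t M A_tᵀ‖_F² ≤ ‖M‖² · ‖∑_{t=1}^T A_t A_tᵀ‖_F², where ‖M‖ is the ℓ²-operator (spectral) norm of M and ‖·‖_F is the Frobenius norm. -/
open scoped BigOperators
open Matrix

/-- Squared Frobenius norm of a real matrix: the sum of the squares of its entries. -/
noncomputable def frobNormSq {m n : Type*} [Fintype m] [Fintype n]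
    (A : Matrix m n ℝ) : ℝ :=
  ∑ i, ∑ j, (A i j) ^ 2

/-- The ℓ²→ℓ² operator (spectral) norm of a real square matrix. -/
noncomputable def l2OpNorm {n : Type*} [Fintype n] [DecidableEq n]
    (M : Matrix n n ℝ) : ℝ :=
  ‖Matrix.toEuclideanCLM (𝕜 := ℝ) M‖

theorem frobNormSq_eq_trace {m n : Type*} [Fintype m] [Fintype n] (A : Matrix m n ℝ) :
    frobNormSq A = (A * Aᵀ).trace := by
  simp [frobNormSq, Matrix.trace, Matrix.mul_apply, sq]

theorem frobNormSq_transpose {m n : Type*} [Fintype m] [Fintype n] (A : Matrix m n ℝ) :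
    frobNormSq Aᵀ = frobNormSq A :=
  Finset.sum_comm

theorem trace_mul_transpose_le {m n : Type*} [Fintype m] [Fintype n] (P Q : Matrix m n ℝ) :
    (P * Qᵀ).trace ≤ (frobNormSq P + frobNormSq Q) / 2 := by
  simp only [frobNormSq, Matrix.trace, Matrix.diag_apply, Matrix.mul_apply,
    Matrix.transpose_apply, ← Finset.sum_add_distrib, Finset.sum_div]
  gcongr with i _ j _
  linarith [two_mul_le_add_sq (P i j) (Q i j)]

theorem l2OpNorm_transpose {n : Type*} [Fintype n] [DecidableEq n] (M : Matrix n n ℝ) :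
    l2OpNorm Mᵀ = l2OpNorm M := by
  rw [l2OpNorm, ← Matrix.conjTranspose_eq_transpose_of_trivial, ← Matrix.star_eq_conjTranspose,
    map_star, ContinuousLinearMap.star_eq_adjoint, LinearIsometryEquiv.norm_map, l2OpNorm]

theorem sum_mulVec_sq_le {n : Type*} [Fintype n] [DecidableEq n] (M : Matrix n n ℝ) (v : n → ℝ) :
    ∑ i, (M *ᵥ v) i ^ 2 ≤ l2OpNorm M ^ 2 * ∑ i, v i ^ 2 := by
  have h := (Matrix.toEuclideanCLM (𝕜 := ℝ) M).le_opNorm (WithLp.toLp 2 v)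
  have h2 := pow_le_pow_left₀ (norm_nonneg _) h 2
  rw [mul_pow, EuclideanSpace.real_norm_sq_eq, EuclideanSpace.real_norm_sq_eq] at h2
  simpa [l2OpNorm] using h2

theorem frobNormSq_mul_le {n k : Type*} [Fintype n] [DecidableEq n] [Fintype k]
    (M : Matrix n n ℝ) (B : Matrix n k ℝ) :
    frobNormSq (M * B) ≤ l2OpNorm M ^ 2 * frobNormSq B := by
  rw [← frobNormSq_transpose (M * B), ← frobNormSq_transpose B, frobNormSq, frobNormSq,
    Finset.mul_sum]
  exact Finset.sum_le_sum fun j _ => sum_mulVec_sq_le M fun i => B i j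

theorem frobNormSq_mul_le' {n k : Type*} [Fintype n] [DecidableEq n] [Fintype k]
    (B : Matrix k n ℝ) (M : Matrix n n ℝ) :
    frobNormSq (B * M) ≤ l2OpNorm M ^ 2 * frobNormSq B := by
  rw [← frobNormSq_transpose (B * M), ← frobNormSq_transpose B, Matrix.transpose_mul,
    ← l2OpNorm_transpose]
  exact frobNormSq_mul_le _ _

theorem frobNormSq_sum_conj_eq {ι m n : Type*} [Fintype ι] [Fintype m] [Fintype n]
    (A : ι → Matrix m n ℝ) (M : Matrix n n ℝ) :
    frobNormSq (∑ t, A t * M * (A t)ᵀ) =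
      ∑ t, ∑ s, (((A s)ᵀ * A t * M) * (M * ((A s)ᵀ * A t))ᵀ).trace := by
  rw [frobNormSq_eq_trace, Matrix.transpose_sum, Matrix.sum_mul, Matrix.trace_sum]
  refine Finset.sum_congr rfl fun t _ => ?_
  rw [Matrix.mul_sum, Matrix.trace_sum]
  refine Finset.sum_congr rfl fun s _ => ?_
  simp only [Matrix.transpose_mul, Matrix.transpose_transpose]
  rw [← Matrix.mul_assoc, ← Matrix.mul_assoc, ← Matrix.mul_assoc, Matrix.trace_mul_comm]
  simp only [Matrix.mul_assoc]

/-- For real `m×n` matrices `A_1, …, A_T` and a real `n×n` matrix `M`,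
`‖∑_t A_t M A_tᵀ‖_F² ≤ ‖M‖² ⬝ ‖∑_t A_t A_tᵀ‖_F²`. -/
theorem frobNormSq_sum_conj_le (T m n : ℕ)
    (A : Fin T → Matrix (Fin m) (Fin n) ℝ) (M : Matrix (Fin n) (Fin n) ℝ) :
    frobNormSq (∑ t, A t * M * (A t)ᵀ) ≤
      (l2OpNorm M) ^ 2 * frobNormSq (∑ t, A t * (A t)ᵀ) := by
  have h := frobNormSq_sum_conj_eq A 1
  simp only [Matrix.mul_one, Matrix.one_mul, ← frobNormSq_eq_trace] at h
  rw [frobNormSq_sum_conj_eq, h, Finset.mul_sum]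
  refine Finset.sum_le_sum fun t _ => ?_
  rw [Finset.mul_sum]
  refine Finset.sum_le_sum fun s _ => ?_
  linarith [trace_mul_transpose_le ((A s)ᵀ * A t * M) (M * ((A s)ᵀ * A t)),
    frobNormSq_mul_le M ((A s)ᵀ * A t), frobNormSq_mul_le' ((A s)ᵀ * A t) M]
end

section
/- Let T ∈ ℕ, let A_1, …, A_T be real m×n matrices, let B_1, …, B_T be real p×q matrices, and let M be a real n×q matrix. Then ‖∑_{t=1}^T A_t M B_tᵀ‖_F² ≤ ‖M‖_F² · ∑_{i=1}^m ∑_{j=1}^n ‖∑_{t=1}^T (A_t)_{ij} · B_t‖_F², where (A_t)_{ij} denotes the (i,j) entry of A_t. -/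
open scoped BigOperators
open Matrix

/-- The entries of `∑ t, A t * M * (B t)ᵀ` as pairings of `M` with the matrices
`∑ t, A t i j • B t`. -/
lemma sum_mul_mul_transpose_apply {τ m n p q : Type*} [Fintype τ] [Fintype n] [Fintype q]
    (A : τ → Matrix m n ℝ) (B : τ → Matrix p q ℝ) (M : Matrix n q ℝ) (i : m) (k : p) :
    (∑ t, A t * M * (B t)ᵀ) i k = ∑ x : n × q, M x.1 x.2 * (∑ t, A t i x.1 • B t) k x.2 := by
  simp only [Matrix.sum_apply, Matrix.mul_apply, Matrix.transpose_apply, Matrix.smul_apply,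
    smul_eq_mul, Fintype.sum_prod_type, Finset.mul_sum, Finset.sum_mul]
  rw [Finset.sum_comm, Finset.sum_comm (s := (Finset.univ : Finset n))]
  refine Finset.sum_congr rfl fun l _ => ?_
  rw [Finset.sum_comm]
  refine Finset.sum_congr rfl fun j _ => Finset.sum_congr rfl fun t _ => ?_
  ring

/-- For real `m×n` matrices `A_1, …, A_T`, real `p×q` matrices `B_1, …, B_T` and a real
`n×q` matrix `M`,
`‖∑_t A_t M B_tᵀ‖_F² ≤ ‖M‖_F² ⬝ ∑_{i=1}^m ∑_{j=1}^n ‖∑_t (A_t)_{ij} B_t‖_F²`. -/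
theorem frobNormSq_sum_sandwich_le (T m n p q : ℕ)
    (A : Fin T → Matrix (Fin m) (Fin n) ℝ)
    (B : Fin T → Matrix (Fin p) (Fin q) ℝ)
    (M : Matrix (Fin n) (Fin q) ℝ) :
    frobNormSq (∑ t, A t * M * (B t)ᵀ) ≤
      frobNormSq M * ∑ i : Fin m, ∑ j : Fin n, frobNormSq (∑ t, A t i j • B t) := by
  calc frobNormSq (∑ t, A t * M * (B t)ᵀ)
      = ∑ i, ∑ k, (∑ x : Fin n × Fin q, M x.1 x.2 * (∑ t, A t i x.1 • B t) k x.2) ^ 2 := by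
        simp only [frobNormSq, sum_mul_mul_transpose_apply]
    _ ≤ ∑ i, ∑ k, (∑ x : Fin n × Fin q, M x.1 x.2 ^ 2) *
          ∑ x : Fin n × Fin q, (∑ t, A t i x.1 • B t) k x.2 ^ 2 := by
        gcongr
        exact Finset.sum_mul_sq_le_sq_mul_sq _ _ _
    _ = frobNormSq M * ∑ i, ∑ j, frobNormSq (∑ t, A t i j • B t) := by
        simp only [frobNormSq, Fintype.sum_prod_type, ← Finset.mul_sum]
        congr 1
        exact Finset.sum_congr rfl fun i _ => Finset.sum_comm
end
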